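/- Let λ ∈ k^c be nonzero. Then the left annihilator of u_λ in A equals the left ideal Au_λ^{a−1}, and the left annihilator of u_λ^{a−1} in A equals the left ideal Au_λ. Consequently the sequences 0 → Au_λ^{a−1} → A →(r ↦ r u_λ) Au_λ → 0 and 0 → Au_λ → A →(r ↦ r u_λ^{a−1}) Au_λ^{a−1} → 0 of left A-modules are exact, so Au_λ and Au_λ^{a−1} are syzygies of each other. -/

import Mathlib

open scoped TensorProduct

/-- The relations defining the quantum complete intersection `A^c_q`:
`x_i ^ a = 0` for all `i`, and `x_i x_j = q • x_j x_i` for `i < j`. -/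
inductive QCIRel (k : Type) [Field k] (c a : ℕ) (q : k) :
    FreeAlgebra k (Fin c) → FreeAlgebra k (Fin c) → Prop
  | pow (i : Fin c) : QCIRel k c a q (FreeAlgebra.ι k i ^ a) 0
  | comm (i j : Fin c) (hij : i < j) :
      QCIRel k c a q (FreeAlgebra.ι k i * FreeAlgebra.ι k j)
        (q • (FreeAlgebra.ι k j * FreeAlgebra.ι k i))

/-- The quantum complete intersection algebra `A^c_q = k⟨x_1,…,x_c⟩/(x_i^a, x_ix_j - q x_jx_i)`. -/
def QCI (k : Type) [Field k] (c a : ℕ) (q : k) : Type := RingQuot (QCIRel k c a q)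

noncomputable instance (k : Type) [Field k] (c a : ℕ) (q : k) : Ring (QCI k c a q) :=
  inferInstanceAs (Ring (RingQuot (QCIRel k c a q)))

noncomputable instance (k : Type) [Field k] (c a : ℕ) (q : k) : Algebra k (QCI k c a q) :=
  inferInstanceAs (Algebra k (RingQuot (QCIRel k c a q)))

namespace QCI

variable (k : Type) [Field k] (c a : ℕ) (q : k)

/-- The generators `x_i` of the quantum complete intersection. -/
noncomputable def x (i : Fin c) : QCI k c a q :=
  RingQuot.mkAlgHom k (QCIRel k c a q) (FreeAlgebra.ι k i)

/-- The element `u_λ = λ_1 x_1 + ⋯ + λ_c x_c` of `A^c_q`. -/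
noncomputable def u (lam : Fin c → k) : QCI k c a q :=
  ∑ i, lam i • QCI.x k c a q i

end QCI

/-- `a' = a / gcd(a, char k)` if `char k > 0`, and `a' = a` if `char k = 0`. -/
noncomputable def aprime (k : Type) [Field k] (a : ℕ) : ℕ :=
  if ringChar k > 0 then a / Nat.gcd a (ringChar k) else a

/-! ### A `q`-analogue of the freshman's dream -/

section QBinomial

variable {k : Type*} [Field k]

/-- The Gaussian binomial coefficients evaluated at `q`. -/
def gaussBinom (q : k) : ℕ → ℕ → k
  | _, 0 => 1
  | 0, _ + 1 => 0
  | n + 1, j + 1 => gaussBinom q n j + q ^ (j + 1) * gaussBinom q n (j + 1)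

/-- The `q`-factorial. -/
def qFactorial (q : k) (n : ℕ) : k := ∏ i ∈ Finset.range n, ∑ j ∈ Finset.range (i + 1), q ^ j

theorem gaussBinom_zero_right (q : k) (n : ℕ) : gaussBinom q n 0 = 1 := by
  cases n <;> rfl

theorem gaussBinom_succ_succ (q : k) (n j : ℕ) :
    gaussBinom q (n + 1) (j + 1) = gaussBinom q n j + q ^ (j + 1) * gaussBinom q n (j + 1) :=
  rfl

theorem gaussBinom_eq_zero_of_lt (q : k) (n : ℕ) : ∀ j, n < j → gaussBinom q n j = 0 := by
  induction n with
  | zero =>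
    rintro (_ | j) h
    · simp at h
    · rfl
  | succ n ih =>
    rintro (_ | j) h
    · simp at h
    · rw [gaussBinom_succ_succ, ih j (by omega), ih (j + 1) (by omega)]
      simp

theorem gaussBinom_self (q : k) (n : ℕ) : gaussBinom q n n = 1 := by
  induction n with
  | zero => rfl
  | succ n ih => simp [gaussBinom_succ_succ, ih, gaussBinom_eq_zero_of_lt q n (n + 1)]

theorem qFactorial_succ (q : k) (n : ℕ) :
    qFactorial q (n + 1) = qFactorial q n * ∑ j ∈ Finset.range (n + 1), q ^ j :=
  Finset.prod_range_succ _ _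

theorem gaussBinom_mul_qFactorial (q : k) (N : ℕ) :
    ∀ n j, n + j = N → gaussBinom q N j * (qFactorial q n * qFactorial q j) = qFactorial q N := by
  induction N with
  | zero =>
    intro n j h
    obtain ⟨rfl, rfl⟩ : n = 0 ∧ j = 0 := by omega
    simp [gaussBinom, qFactorial]
  | succ N ih =>
    rintro n (_ | j) h
    · obtain rfl : n = N + 1 := by omega
      simp [gaussBinom, qFactorial]
    rcases n with _ | n
    · obtain rfl : j = N := by omega
      rw [gaussBinom_self]
      simp [qFactorial]
    · have h1 := ih (n + 1) j (by omega)
      have h2 := ih n (j + 1) (by omega)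
      have h3 : ∑ i ∈ Finset.range (N + 1), q ^ i
          = ∑ i ∈ Finset.range (j + 1), q ^ i
            + q ^ (j + 1) * ∑ i ∈ Finset.range (n + 1), q ^ i := by
        rw [show N + 1 = (j + 1) + (n + 1) by omega, Finset.sum_range_add, Finset.mul_sum]
        simp [pow_add]
      rw [gaussBinom_succ_succ, qFactorial_succ q N, h3, mul_add, ← mul_assoc]
      nth_rewrite 1 [← h1]
      rw [← h2, qFactorial_succ q n, qFactorial_succ q j]
      ring

theorem qFactorial_ne_zero {q : k} {m : ℕ} (hq : IsPrimitiveRoot q m) {n : ℕ} (hn : n < m) :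
    qFactorial q n ≠ 0 := by
  rw [qFactorial, Finset.prod_ne_zero_iff]
  intro i hi h0
  have h := geom_sum_mul q (i + 1)
  rw [h0, zero_mul] at h
  have := hq.dvd_of_pow_eq_one (i + 1) (sub_eq_zero.mp h.symm)
  have := Nat.le_of_dvd (Nat.succ_pos _) this
  have := Finset.mem_range.mp hi
  omega

theorem gaussBinom_eq_zero {q : k} {m : ℕ} (hq : IsPrimitiveRoot q m) {j : ℕ} (h0 : 0 < j)
    (hj : j < m) : gaussBinom q m j = 0 := by
  have h := gaussBinom_mul_qFactorial q m (m - j) j (by omega)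
  have hz : qFactorial q m = 0 :=
    Finset.prod_eq_zero (i := m - 1) (by simp; omega)
      (by rw [Nat.sub_add_cancel (by omega)]; exact hq.geom_sum_eq_zero (by omega))
  rw [hz] at h
  exact (mul_eq_zero.mp h).resolve_right
    (mul_ne_zero (qFactorial_ne_zero hq (by omega)) (qFactorial_ne_zero hq hj))

variable {A : Type*} [Ring A] [Algebra k A]

theorem mul_pow_of_qComm {q : k} {y z : A} (h : y * z = q • (z * y)) (n : ℕ) :
    y * z ^ n = q ^ n • (z ^ n * y) := by
  induction n with
  | zero => simp
  | succ n ih =>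
    rw [pow_succ, ← mul_assoc, ih, smul_mul_assoc, mul_assoc, h, mul_smul_comm, smul_smul,
      ← pow_succ, mul_assoc]

theorem add_pow_of_qComm {q : k} {y z : A} (h : y * z = q • (z * y)) (n : ℕ) :
    (y + z) ^ n = ∑ j ∈ Finset.range (n + 1), gaussBinom q n j • (z ^ j * y ^ (n - j)) := by
  induction n with
  | zero => simp [gaussBinom]
  | succ n ih =>
    have hy : y * (y + z) ^ n = ∑ j ∈ Finset.range (n + 2),
        (q ^ j * gaussBinom q n j) • (z ^ j * y ^ (n + 1 - j)) := by
      rw [Finset.sum_range_succ, gaussBinom_eq_zero_of_lt q n (n + 1) (by omega), mul_zero,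
        zero_smul, add_zero, ih, Finset.mul_sum]
      refine Finset.sum_congr rfl fun j hj => ?_
      have hj' := Finset.mem_range.mp hj
      rw [mul_smul_comm, ← mul_assoc, mul_pow_of_qComm h, smul_mul_assoc, smul_smul, mul_assoc,
        ← pow_succ', mul_comm, show n - j + 1 = n + 1 - j by omega]
    have hz : z * (y + z) ^ n = ∑ j ∈ Finset.range (n + 1),
        gaussBinom q n j • (z ^ (j + 1) * y ^ (n + 1 - (j + 1))) := by
      rw [ih, Finset.mul_sum]
      refine Finset.sum_congr rfl fun j _ => ?_
      rw [mul_smul_comm, ← mul_assoc, ← pow_succ', Nat.add_sub_add_right]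
    rw [pow_succ', add_mul, hy, hz, Finset.sum_range_succ', Finset.sum_range_succ' _ (n + 1),
      add_right_comm, ← Finset.sum_add_distrib]
    congr 1
    · refine Finset.sum_congr rfl fun j _ => ?_
      rw [← add_smul, gaussBinom_succ_succ, add_comm]
    · simp [gaussBinom_zero_right]

theorem add_pow_eq_of_qComm {q : k} {m : ℕ} (hm : 0 < m) (hq : IsPrimitiveRoot q m) {y z : A}
    (h : y * z = q • (z * y)) : (y + z) ^ m = y ^ m + z ^ m := by
  obtain ⟨m, rfl⟩ := Nat.exists_eq_succ_of_ne_zero hm.ne'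
  rw [Nat.succ_eq_add_one] at *
  rw [add_pow_of_qComm h, Finset.sum_range_succ, Finset.sum_range_succ', gaussBinom_self,
    gaussBinom_zero_right, Finset.sum_eq_zero]
  · simp
  · intro j hj
    rw [gaussBinom_eq_zero hq (by omega) (by simpa using hj), zero_smul]

theorem commute_pow_of_qComm {q : k} {m : ℕ} (hq : IsPrimitiveRoot q m) {y z : A}
    (h : y * z = q • (z * y)) : Commute (y ^ m) (z ^ m) := by
  have h1 : Commute y (z ^ m) := by
    rw [Commute, SemiconjBy, mul_pow_of_qComm h, hq.pow_eq_one, one_smul]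
  exact h1.pow_left m

theorem aprime_pos (k : Type) [Field k] {a : ℕ} (ha : 0 < a) : 0 < aprime k a := by
  unfold aprime
  split_ifs with h
  · exact Nat.div_pos (Nat.le_of_dvd ha (Nat.gcd_dvd_left _ _)) (Nat.gcd_pos_of_pos_left _ ha)
  · exact ha

theorem add_pow_eq_of_aprime {k : Type} [Field k] {A : Type*} [Ring A] [Algebra k A] {q : k}
    {a : ℕ} (ha : 0 < a) (hq : IsPrimitiveRoot q (aprime k a)) {y z : A}
    (h : y * z = q • (z * y)) : (y + z) ^ a = y ^ a + z ^ a := by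
  nontriviality A
  have hm := add_pow_eq_of_qComm (aprime_pos k ha) hq h
  have hc := commute_pow_of_qComm hq h
  by_cases hd : 0 < ringChar k ∧ ringChar k ∣ a
  · obtain ⟨h0, hd⟩ := hd
    have hp : Fact (ringChar k).Prime :=
      ⟨(CharP.char_is_prime_or_zero k (ringChar k)).resolve_right h0.ne'⟩
    have : CharP A (ringChar k) :=
      charP_of_injective_algebraMap (algebraMap k A).injective (ringChar k)
    have hap : aprime k a * ringChar k = a := by
      rw [aprime, if_pos h0, Nat.gcd_eq_right hd, Nat.div_mul_cancel hd]
    rw [← hap, pow_mul, hm, add_pow_char_of_commute (ringChar k) hc, ← pow_mul, ← pow_mul]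
  · have hap : aprime k a = a := by
      unfold aprime
      split_ifs with h0
      · have hp := (CharP.char_is_prime_or_zero k (ringChar k)).resolve_right h0.ne'
        have : Nat.Coprime a (ringChar k) :=
          ((Nat.Prime.coprime_iff_not_dvd hp).mpr fun h => hd ⟨h0, h⟩).symm
        rw [this.gcd_eq_one, Nat.div_one]
      · rfl
    rwa [hap] at hm

end QBinomial

/-! ### Nilpotent endomorphisms with small kernel -/

section Nilpotent

variable {k V : Type*} [Field k] [AddCommGroup V] [Module k V] [FiniteDimensional k V]

theorem finrank_ker_pow_le (f : V →ₗ[k] V) (j : ℕ) :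
    Module.finrank k (LinearMap.ker (f ^ j)) ≤ j * Module.finrank k (LinearMap.ker f) := by
  induction j with
  | zero =>
    rw [pow_zero, show LinearMap.ker (1 : V →ₗ[k] V) = ⊥ from LinearMap.ker_id]
    simp
  | succ j ih =>
    let g : LinearMap.ker (f ^ (j + 1)) →ₗ[k] V := f.comp (LinearMap.ker (f ^ (j + 1))).subtype
    have hr : LinearMap.range g ≤ LinearMap.ker (f ^ j) := by
      rintro _ ⟨⟨v, hv⟩, rfl⟩
      rw [LinearMap.mem_ker, pow_succ] at hv
      exact hv
    have hk : Module.finrank k (LinearMap.ker g) ≤ Module.finrank k (LinearMap.ker f) := by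
      let e : LinearMap.ker g →ₗ[k] LinearMap.ker f :=
        LinearMap.codRestrict _ ((Submodule.subtype _).comp (Submodule.subtype _))
          fun v => v.2
      exact LinearMap.finrank_le_finrank_of_injective (f := e) fun v w h =>
        Subtype.ext (Subtype.ext (congrArg (LinearMap.ker f).subtype h :))
    have h1 := LinearMap.finrank_range_add_finrank_ker g
    have h2 := Submodule.finrank_mono hr
    rw [add_mul, one_mul]
    omega

theorem ker_eq_range_pow_of_finrank (f : V →ₗ[k] V) {a n : ℕ} (hf : f ^ a = 0)
    (hk : Module.finrank k (LinearMap.ker f) ≤ n) (hV : a * n ≤ Module.finrank k V)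
    {i j : ℕ} (hij : i + j = a) : LinearMap.ker (f ^ i) = LinearMap.range (f ^ j) := by
  symm
  apply Submodule.eq_of_le_of_finrank_le
  · rintro _ ⟨v, rfl⟩
    rw [LinearMap.mem_ker, ← Module.End.mul_apply, ← pow_add, hij, hf, LinearMap.zero_apply]
  · have h1 := LinearMap.finrank_range_add_finrank_ker (f ^ j)
    have h2 := (finrank_ker_pow_le f j).trans (Nat.mul_le_mul_left j hk)
    have h3 := (finrank_ker_pow_le f i).trans (Nat.mul_le_mul_left i hk)
    rw [← hij, add_mul] at hV
    omega

end Nilpotent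

theorem Algebra.adjoin_toSubmodule_le_of_mul_mem {k A : Type*} [Field k] [Ring A] [Algebra k A]
    {s : Set A} {N : Submodule k A} (h1 : 1 ∈ N) (hs : ∀ x ∈ s, ∀ n ∈ N, x * n ∈ N) :
    Subalgebra.toSubmodule (Algebra.adjoin k s) ≤ N := by
  rw [Algebra.adjoin_eq_span, Submodule.span_le]
  intro y hy
  induction hy using Submonoid.closure_induction_left with
  | one => exact h1
  | mul_left x hx y _ ih => exact hs x hx y ih

namespace QCI

variable {k : Type} [Field k] {c a : ℕ} {q : k}

theorem x_pow (i : Fin c) : x k c a q i ^ a = 0 := by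
  have h := RingQuot.mkAlgHom_rel k (QCIRel.pow (k := k) (a := a) (q := q) i)
  rw [map_pow, map_zero] at h
  exact h

theorem x_mul_x {i j : Fin c} (hij : i < j) :
    x k c a q i * x k c a q j = q • (x k c a q j * x k c a q i) := by
  have h := RingQuot.mkAlgHom_rel k (QCIRel.comm (k := k) (a := a) (q := q) i j hij)
  rw [map_mul, map_smul, map_mul] at h
  exact h

theorem adjoin_range_x : Algebra.adjoin k (Set.range (x k c a q)) = ⊤ := by
  have h := AlgHom.map_adjoin (RingQuot.mkAlgHom k (QCIRel k c a q))
    (Set.range (FreeAlgebra.ι k))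
  rw [FreeAlgebra.adjoin_range_ι, Algebra.map_top, ← Set.range_comp,
    (AlgHom.range_eq_top _).mpr (RingQuot.mkAlgHom_surjective k _)] at h
  exact h.symm

theorem exists_x_mul_x (hq : q ≠ 0) {i j : Fin c} (hij : i ≠ j) :
    ∃ r : k, x k c a q i * x k c a q j = r • (x k c a q j * x k c a q i) := by
  rcases lt_or_gt_of_ne hij with h | h
  · exact ⟨q, x_mul_x h⟩
  · refine ⟨q⁻¹, ?_⟩
    rw [x_mul_x h, smul_smul, inv_mul_cancel₀ hq, one_smul]

theorem sum_pow_eq_zero (ha : 0 < a) (hq : IsPrimitiveRoot q (aprime k a)) (lam : Fin c → k)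
    (s : Finset (Fin c)) : (∑ i ∈ s, lam i • x k c a q i) ^ a = 0 := by
  induction s using Finset.induction_on_max with
  | empty => simp [ha.ne']
  | insert d s hs ih =>
    rw [Finset.sum_insert fun h => (hs d h).false, add_comm, add_pow_eq_of_aprime ha hq, ih,
      smul_pow, x_pow, smul_zero, add_zero]
    rw [Finset.sum_mul, Finset.mul_sum, Finset.smul_sum]
    refine Finset.sum_congr rfl fun i hi => ?_
    rw [smul_mul_smul_comm, smul_mul_smul_comm, x_mul_x (hs i hi), smul_comm, mul_comm]

theorem u_pow (ha : 0 < a) (hq : IsPrimitiveRoot q (aprime k a)) (lam : Fin c → k) :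
    u k c a q lam ^ a = 0 :=
  sum_pow_eq_zero ha hq lam Finset.univ

/-- The subalgebra generated by the `x_i` with `i ∈ s`. -/
noncomputable def sub (k : Type) [Field k] (c a : ℕ) (q : k) (s : Set (Fin c)) :
    Subalgebra k (QCI k c a q) :=
  Algebra.adjoin k (x k c a q '' s)

theorem x_mem_sub {s : Set (Fin c)} {i : Fin c} (hi : i ∈ s) : x k c a q i ∈ sub k c a q s :=
  Algebra.subset_adjoin (Set.mem_image_of_mem _ hi)

theorem exists_x_mul_eq_mul_x (hq : q ≠ 0) {s : Set (Fin c)} {d : Fin c} (hd : d ∉ s)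
    {b : QCI k c a q} (hb : b ∈ sub k c a q s) :
    ∃ b' ∈ sub k c a q s, x k c a q d * b = b' * x k c a q d := by
  induction hb using Algebra.adjoin_induction with
  | mem b hb =>
    obtain ⟨i, hi, rfl⟩ := hb
    obtain ⟨r, hr⟩ := exists_x_mul_x (a := a) hq (i := d) (j := i) (fun h => hd (h ▸ hi))
    exact ⟨r • x k c a q i, Subalgebra.smul_mem _ (x_mem_sub hi) r, by
      rw [hr, smul_mul_assoc]⟩
  | algebraMap r => exact ⟨_, Subalgebra.algebraMap_mem _ r, (Algebra.commutes r _).symm⟩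
  | add b₁ b₂ _ _ h₁ h₂ =>
    obtain ⟨b₁', hb₁, h₁⟩ := h₁
    obtain ⟨b₂', hb₂, h₂⟩ := h₂
    exact ⟨b₁' + b₂', add_mem hb₁ hb₂, by rw [mul_add, h₁, h₂, add_mul]⟩
  | mul b₁ b₂ _ _ h₁ h₂ =>
    obtain ⟨b₁', hb₁, h₁⟩ := h₁
    obtain ⟨b₂', hb₂, h₂⟩ := h₂
    exact ⟨b₁' * b₂', mul_mem hb₁ hb₂, by rw [← mul_assoc, h₁, mul_assoc, h₂, mul_assoc]⟩

/-- The map `(b_j) ↦ ∑ b_j x_d ^ j` on coefficients from `sub k c a q s`. -/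
noncomputable def coeffMap (s : Set (Fin c)) (d : Fin c) :
    (Fin a → Subalgebra.toSubmodule (sub k c a q s)) →ₗ[k] QCI k c a q :=
  ∑ j : Fin a, (LinearMap.mulRight k (x k c a q d ^ (j : ℕ))).comp
    ((Submodule.subtype _).comp (LinearMap.proj j))

theorem coeffMap_apply (s : Set (Fin c)) (d : Fin c)
    (f : Fin a → Subalgebra.toSubmodule (sub k c a q s)) :
    coeffMap s d f = ∑ j, (f j : QCI k c a q) * x k c a q d ^ (j : ℕ) := by
  simp [coeffMap]

theorem mul_pow_mem_range_coeffMap {s : Set (Fin c)} (d : Fin c) {b : QCI k c a q}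
    (hb : b ∈ sub k c a q s) (j : ℕ) :
    b * x k c a q d ^ j ∈ LinearMap.range (coeffMap (k := k) (a := a) (q := q) s d) := by
  by_cases hj : j < a
  · refine ⟨Pi.single ⟨j, hj⟩ ⟨b, hb⟩, ?_⟩
    rw [coeffMap_apply, Finset.sum_eq_single ⟨j, hj⟩]
    · simp
    · intro i _ hi
      simp [Pi.single_eq_of_ne hi]
    · simp
  · rw [pow_eq_zero_of_le (not_lt.mp hj) (x_pow d), mul_zero]
    exact zero_mem _

theorem sub_insert_le (hq : q ≠ 0) {s : Set (Fin c)} {d : Fin c} (hd : d ∉ s) :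
    Subalgebra.toSubmodule (sub k c a q (insert d s))
      ≤ LinearMap.range (coeffMap (k := k) (a := a) (q := q) s d) := by
  apply Algebra.adjoin_toSubmodule_le_of_mul_mem
  · simpa using mul_pow_mem_range_coeffMap (a := a) d (one_mem (sub k c a q s)) 0
  · rintro _ ⟨i, hi, rfl⟩ _ ⟨f, rfl⟩
    rw [coeffMap_apply, Finset.mul_sum]
    refine Submodule.sum_mem _ fun j _ => ?_
    rcases hi with rfl | hi
    · obtain ⟨b, hb, h⟩ := exists_x_mul_eq_mul_x hq hd (f j).2
      rw [← mul_assoc, h, mul_assoc, ← pow_succ']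
      exact mul_pow_mem_range_coeffMap i hb _
    · rw [← mul_assoc]
      exact mul_pow_mem_range_coeffMap d (mul_mem (x_mem_sub hi) (f j).2) _

theorem finrank_sub_le (hq : q ≠ 0) (s : Finset (Fin c)) :
    FiniteDimensional k (Subalgebra.toSubmodule (sub k c a q (s : Set (Fin c)))) ∧
      Module.finrank k (Subalgebra.toSubmodule (sub k c a q (s : Set (Fin c))))
        ≤ a ^ s.card := by
  induction s using Finset.induction_on with
  | empty =>
    have h : Subalgebra.toSubmodule (sub k c a q ((∅ : Finset (Fin c)) : Set (Fin c)))
        = Submodule.span k {1} := by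
      rw [sub, Finset.coe_empty, Set.image_empty, Algebra.adjoin_empty, Algebra.toSubmodule_bot,
        Submodule.one_eq_span]
    rw [h]
    exact ⟨inferInstance, (finrank_span_le_card _).trans (by simp)⟩
  | insert d s hd ih =>
    obtain ⟨_, hs⟩ := ih
    have hle := sub_insert_le (a := a) hq (s := (s : Set (Fin c))) (d := d) (by simpa using hd)
    rw [Finset.coe_insert, Finset.card_insert_of_notMem hd]
    refine ⟨Submodule.finiteDimensional_of_le hle, ?_⟩
    calc _ ≤ _ := Submodule.finrank_mono hle
      _ ≤ _ := LinearMap.finrank_range_le _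
      _ = a * Module.finrank k (Subalgebra.toSubmodule (sub k c a q (s : Set (Fin c)))) := by
        rw [Module.finrank_pi_fintype]; simp
      _ ≤ a * a ^ s.card := Nat.mul_le_mul_left a hs
      _ = a ^ (s.card + 1) := (pow_succ' _ _).symm

theorem finiteDimensional (hq : q ≠ 0) : FiniteDimensional k (QCI k c a q) := by
  have h := (finrank_sub_le (a := a) hq (Finset.univ : Finset (Fin c))).1
  rw [sub, Finset.coe_univ, Set.image_univ, adjoin_range_x, Algebra.top_toSubmodule] at h
  exact Module.finite_def.mpr ((Submodule.fg_iff_finiteDimensional _).mpr h)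

theorem sub_sup_range_mulRight_u (hq : q ≠ 0) {lam : Fin c → k} {d : Fin c} (hd : lam d ≠ 0) :
    Subalgebra.toSubmodule (sub k c a q {d}ᶜ)
      ⊔ LinearMap.range (LinearMap.mulRight k (u k c a q lam)) = ⊤ := by
  rw [eq_top_iff, ← Algebra.top_toSubmodule, ← adjoin_range_x]
  apply Algebra.adjoin_toSubmodule_le_of_mul_mem
  · exact Submodule.mem_sup_left (one_mem (sub k c a q {d}ᶜ))
  rintro _ ⟨i, rfl⟩ n hn
  obtain ⟨b, hb, _, ⟨r, rfl⟩, rfl⟩ := Submodule.mem_sup.mp hn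
  rw [mul_add]
  refine add_mem ?_ (Submodule.mem_sup_right ⟨x k c a q i * r, by simp [mul_assoc]⟩)
  by_cases hi : i = d
  · subst hi
    obtain ⟨b', hb', h⟩ := exists_x_mul_eq_mul_x hq (d := i) (by simp) hb
    have hx : x k c a q i = (lam i)⁻¹ • (u k c a q lam
        - ∑ j ∈ Finset.univ.erase i, lam j • x k c a q j) := by
      rw [u, ← Finset.add_sum_erase _ _ (Finset.mem_univ i), add_sub_cancel_right, smul_smul,
        inv_mul_cancel₀ hd, one_smul]
    rw [h, hx, mul_smul_comm, mul_sub]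
    refine Submodule.smul_mem _ _ (sub_mem (Submodule.mem_sup_right ⟨b', by simp⟩)
      (Submodule.mem_sup_left ((sub k c a q {i}ᶜ).mul_mem hb' (Subalgebra.sum_mem _ fun j hj => ?_))))
    exact Subalgebra.smul_mem _ (x_mem_sub (by simpa using hj)) _
  · exact Submodule.mem_sup_left
      ((sub k c a q {d}ᶜ).mul_mem (x_mem_sub (by simpa using hi)) hb)

theorem finrank_ker_mulRight_u_le (hq : q ≠ 0) {lam : Fin c → k} {d : Fin c} (hd : lam d ≠ 0) :
    Module.finrank k (LinearMap.ker (LinearMap.mulRight k (u k c a q lam))) ≤ a ^ (c - 1) := by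
  have := finiteDimensional (c := c) (a := a) hq
  obtain ⟨_, h1⟩ := finrank_sub_le (a := a) hq ({d}ᶜ : Finset (Fin c))
  rw [Finset.card_compl, Finset.card_singleton, Fintype.card_fin] at h1
  have h2 := LinearMap.finrank_range_add_finrank_ker (LinearMap.mulRight k (u k c a q lam))
  have h3 := Submodule.finrank_add_le_finrank_add_finrank
    (Subalgebra.toSubmodule (sub k c a q {d}ᶜ))
    (LinearMap.range (LinearMap.mulRight k (u k c a q lam)))
  rw [sub_sup_range_mulRight_u hq hd, finrank_top] at h3
  rw [Finset.coe_compl, Finset.coe_singleton] at h1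
  omega

/-! ### The monomial representation -/

/-- The operator by which `x_i` acts on the space spanned by ordered monomials, which are indexed
by their exponents. -/
noncomputable def monomialOp (k : Type) [Field k] (c a : ℕ) (q : k) (i : Fin c) :
    Module.End k ((Fin c → ℕ) →₀ k) :=
  Finsupp.linearCombination k fun m =>
    if m i + 1 < a then Finsupp.single (m + Pi.single i 1) (q ^ ∑ j ∈ Finset.Ioi i, m j) else 0

theorem monomialOp_single (i : Fin c) (m : Fin c → ℕ) :
    monomialOp k c a q i (Finsupp.single m 1) =
      if m i + 1 < a then q ^ (∑ j ∈ Finset.Ioi i, m j) • Finsupp.single (m + Pi.single i 1) 1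
      else 0 := by
  simp [monomialOp]

theorem monomialOp_pow_single (i : Fin c) (n : ℕ) :
    ∀ m : Fin c → ℕ, 0 < n → a ≤ m i + n →
      (monomialOp k c a q i ^ n) (Finsupp.single m 1) = 0 := by
  induction n with
  | zero => intro m h; exact absurd h (lt_irrefl 0)
  | succ n ih =>
    intro m _ h
    rw [pow_succ, Module.End.mul_apply, monomialOp_single]
    split_ifs with hm
    · rw [map_smul, ih _ (by omega) (by simp; omega), smul_zero]
    · rw [map_zero]

theorem monomialOp_pow (ha : 0 < a) (i : Fin c) : monomialOp k c a q i ^ a = 0 := by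
  refine Finsupp.lhom_ext' fun m => LinearMap.ext_ring ?_
  exact monomialOp_pow_single i a m ha (by omega)

theorem monomialOp_comm {i j : Fin c} (hij : i < j) :
    monomialOp k c a q i * monomialOp k c a q j
      = q • (monomialOp k c a q j * monomialOp k c a q i) := by
  refine Finsupp.lhom_ext' fun m => LinearMap.ext_ring ?_
  have hi : (m + Pi.single j 1 : Fin c → ℕ) i = m i := by simp [hij.ne]
  have hj : (m + Pi.single i 1 : Fin c → ℕ) j = m j := by simp [hij.ne']
  have hsi : ∑ l ∈ Finset.Ioi i, (m + Pi.single j 1 : Fin c → ℕ) l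
      = ∑ l ∈ Finset.Ioi i, m l + 1 := by
    simp [Finset.sum_add_distrib, Finset.sum_pi_single', hij]
  have hsj : ∑ l ∈ Finset.Ioi j, (m + Pi.single i 1 : Fin c → ℕ) l
      = ∑ l ∈ Finset.Ioi j, m l := by
    simp [Finset.sum_add_distrib, Finset.sum_pi_single', hij.le]
  simp only [LinearMap.comp_apply, Finsupp.lsingle_apply, LinearMap.smul_apply,
    Module.End.mul_apply, monomialOp_single]
  by_cases h1 : m i + 1 < a <;> by_cases h2 : m j + 1 < a <;>
    simp only [h1, h2, if_true, if_false, map_smul, map_zero, monomialOp_single, hi, hj, smul_zero,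
      hsi, hsj, smul_smul]
  rw [add_right_comm]
  congr 1
  ring

/-- The action of `A^c_q` on ordered monomials. -/
noncomputable def monomialRep (q : k) (c : ℕ) (ha : 0 < a) :
    QCI k c a q →ₐ[k] Module.End k ((Fin c → ℕ) →₀ k) :=
  RingQuot.liftAlgHom k ⟨FreeAlgebra.lift k (monomialOp k c a q), by
    intro y z h
    cases h with
    | pow i => rw [map_pow, FreeAlgebra.lift_ι_apply, monomialOp_pow ha, map_zero]
    | comm i j hij =>
      rw [map_mul, map_smul, map_mul, FreeAlgebra.lift_ι_apply, FreeAlgebra.lift_ι_apply,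
        monomialOp_comm hij]⟩

theorem monomialRep_x (ha : 0 < a) (i : Fin c) :
    monomialRep q c ha (x k c a q i) = monomialOp k c a q i := by
  refine (RingQuot.liftAlgHom_mkAlgHom_apply k _ _ _).trans ?_
  exact FreeAlgebra.lift_ι_apply _ _

theorem exists_monomialRep_eq_single (hq : q ≠ 0) (ha : 0 < a) (n : ℕ) :
    ∀ m : Fin c → ℕ, (∀ i, m i < a) → ∑ i, m i = n →
      ∃ r : QCI k c a q, monomialRep q c ha r (Finsupp.single 0 1) = Finsupp.single m 1 := by
  induction n with
  | zero =>
    intro m _ h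
    obtain rfl : m = 0 := by
      funext i
      simpa using Finset.sum_eq_zero_iff.mp h i (Finset.mem_univ i)
    exact ⟨1, by simp⟩
  | succ n ih =>
    intro m hm h
    obtain ⟨i, -, hi⟩ : ∃ i ∈ Finset.univ, m i ≠ 0 :=
      Finset.exists_ne_zero_of_sum_ne_zero (by omega)
    obtain ⟨m, rfl⟩ : ∃ m' : Fin c → ℕ, m = m' + Pi.single i 1 := by
      refine ⟨m - Pi.single i 1, funext fun j => ?_⟩
      by_cases hj : j = i
      · subst hj
        simp only [Pi.add_apply, Pi.sub_apply, Pi.single_eq_same]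
        omega
      · simp [hj]
    obtain ⟨r, hr⟩ := ih m (fun j => lt_of_le_of_lt (by simp) (hm j)) (by
      simpa [Finset.sum_add_distrib] using h)
    refine ⟨(q ^ ∑ j ∈ Finset.Ioi i, m j)⁻¹ • (x k c a q i * r), ?_⟩
    have hmi : m i + 1 < a := by simpa using hm i
    rw [map_smul, map_mul, LinearMap.smul_apply, Module.End.mul_apply, hr, monomialRep_x,
      monomialOp_single, if_pos hmi, smul_smul, inv_mul_cancel₀ (pow_ne_zero _ hq), one_smul]

theorem pow_le_finrank (hq : q ≠ 0) (ha : 0 < a) : a ^ c ≤ Module.finrank k (QCI k c a q) := by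
  have := finiteDimensional (c := c) (a := a) hq
  choose r hr using fun m : Fin c → Fin a =>
    exists_monomialRep_eq_single (k := k) hq ha _ (fun i => (m i : ℕ)) (fun i => (m i).2) rfl
  let φ : QCI k c a q →ₗ[k] ((Fin c → ℕ) →₀ k) :=
    (LinearMap.applyₗ (Finsupp.single 0 1)).comp (monomialRep q c ha).toLinearMap
  have hinj : Function.Injective fun (m : Fin c → Fin a) (i : Fin c) => (m i : ℕ) :=
    fun m m' h => funext fun i => Fin.ext (congrFun h i)
  have hli : LinearIndependent k (φ ∘ r) := by
    have h := (Finsupp.basisSingleOne (R := k) (ι := Fin c → ℕ)).linearIndependent.comp _ hinj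
    convert h using 1
    funext m
    simpa [φ] using hr m
  simpa using (LinearIndependent.of_comp φ hli).fintype_card_le_finrank

theorem mul_pow_u_eq_zero_iff (ha : 2 ≤ a) (hc : 1 ≤ c) (hq : IsPrimitiveRoot q (aprime k a))
    {lam : Fin c → k} (hlam : lam ≠ 0) {i j : ℕ} (hij : i + j = a) (r : QCI k c a q) :
    r * u k c a q lam ^ i = 0 ↔ ∃ b, b * u k c a q lam ^ j = r := by
  have hq0 : q ≠ 0 := hq.ne_zero (aprime_pos k (by omega)).ne'
  have := finiteDimensional (c := c) (a := a) hq0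
  obtain ⟨d, hd⟩ := Function.ne_iff.mp hlam
  have hu : LinearMap.mulRight k (u k c a q lam) ^ a = 0 := by
    rw [LinearMap.pow_mulRight, u_pow (by omega) hq, LinearMap.mulRight_zero_eq_zero]
  have hdim : a * a ^ (c - 1) ≤ Module.finrank k (QCI k c a q) := by
    rw [← pow_succ', Nat.sub_add_cancel hc]
    exact pow_le_finrank hq0 (by omega)
  have h := SetLike.ext_iff.mp (ker_eq_range_pow_of_finrank _ hu
    (finrank_ker_mulRight_u_le hq0 hd) hdim hij) r
  simpa [LinearMap.pow_mulRight] using h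

end QCI

/-- For nonzero `λ ∈ k^c`, the left annihilator of `u_λ` in `A` equals `Au_λ^{a-1}` and the left
annihilator of `u_λ^{a-1}` equals `Au_λ`; moreover the maps `r ↦ r u_λ` and `r ↦ r u_λ^{a-1}`
have images `Au_λ` and `Au_λ^{a-1}` respectively, so that the sequences
`0 → Au_λ^{a-1} → A → Au_λ → 0` and `0 → Au_λ → A → Au_λ^{a-1} → 0` are exact and
`Au_λ` and `Au_λ^{a-1}` are syzygies of each other. -/
theorem annihilator_uLam (k : Type) [Field k] [IsAlgClosed k] (a c : ℕ)
    (ha : 2 ≤ a) (hc : 1 ≤ c) (q : k) (hq : IsPrimitiveRoot q (aprime k a))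
    (lam : Fin c → k) (hlam : lam ≠ 0) :
    LinearMap.ker (LinearMap.toSpanSingleton (QCI k c a q) (QCI k c a q)
        (QCI.u k c a q lam))
      = Submodule.span (QCI k c a q) {QCI.u k c a q lam ^ (a - 1)} ∧
    LinearMap.ker (LinearMap.toSpanSingleton (QCI k c a q) (QCI k c a q)
        (QCI.u k c a q lam ^ (a - 1)))
      = Submodule.span (QCI k c a q) {QCI.u k c a q lam} ∧
    LinearMap.range (LinearMap.toSpanSingleton (QCI k c a q) (QCI k c a q)
        (QCI.u k c a q lam))
      = Submodule.span (QCI k c a q) {QCI.u k c a q lam} ∧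
    LinearMap.range (LinearMap.toSpanSingleton (QCI k c a q) (QCI k c a q)
        (QCI.u k c a q lam ^ (a - 1)))
      = Submodule.span (QCI k c a q) {QCI.u k c a q lam ^ (a - 1)} := by
  refine ⟨?_, ?_, LinearMap.range_toSpanSingleton _, LinearMap.range_toSpanSingleton _⟩
  · ext r
    simpa [Submodule.mem_span_singleton] using
      QCI.mul_pow_u_eq_zero_iff ha hc hq hlam (show 1 + (a - 1) = a by omega) r
  · ext r
    simpa [Submodule.mem_span_singleton] using
      QCI.mul_pow_u_eq_zero_iff ha hc hq hlam (show (a - 1) + 1 = a by omega) r
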